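/- For every integer k ≥ 3, q(K_1 ∨ ((k−2)P_2 ∪ S_4 ∪ P_1)) > q(K_1 ∨ ((k−3)P_2 ∪ 2S_3 ∪ P_1)). -/

import Mathlib

namespace QPaper

open SimpleGraph

/-- The signless Laplacian matrix `Q(G) = D(G) + A(G)` of a graph, over `ℝ`. -/
noncomputable def signlessLap {V : Type*} [Fintype V] [DecidableEq V] (G : SimpleGraph V) :
    Matrix V V ℝ :=
  letI := Classical.decRel G.Adj
  G.degMatrix ℝ + G.adjMatrix ℝ

/-- The `Q`-index of a graph: the largest eigenvalue of its signless Laplacian matrix. -/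
noncomputable def qIndex {V : Type*} [Fintype V] [DecidableEq V] (G : SimpleGraph V) : ℝ :=
  sSup (spectrum ℝ (signlessLap G))

/-- The number of edges (size) of a graph. -/
noncomputable def numEdges {V : Type*} (G : SimpleGraph V) : ℕ :=
  Nat.card G.edgeSet

/-- The degree of a vertex. -/
noncomputable def deg {V : Type*} (G : SimpleGraph V) (v : V) : ℕ :=
  Nat.card (G.neighborSet v)

/-- A graph is `2` leaves-free if it has at most one vertex of degree one. -/
def TwoLeavesFree {V : Type*} (G : SimpleGraph V) : Prop :=
  ∀ u v : V, deg G u = 1 → deg G v = 1 → u = v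

/-- The maximum degree `Δ(G)`. -/
noncomputable def maxDeg {V : Type*} [Fintype V] (G : SimpleGraph V) : ℕ :=
  letI := Classical.decEq V
  letI := Classical.decRel G.Adj
  G.maxDegree

/-- `k` disjoint copies of `P₂`, i.e. a perfect matching on `2k` vertices. -/
def matching (k : ℕ) : SimpleGraph (Fin k × Fin 2) :=
  SimpleGraph.fromRel (fun a b => a.1 = b.1)

/-- The star graph `Sₙ` on `n` vertices (`K_{1,n-1}` with center `0`). -/
def starGraph (n : ℕ) : SimpleGraph (Fin n) :=
  SimpleGraph.fromRel (fun a _ => (a : ℕ) = 0)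

/-- Disjoint union of two graphs. -/
def dUnion {α β : Type*} (G : SimpleGraph α) (H : SimpleGraph β) : SimpleGraph (α ⊕ β) :=
  SimpleGraph.fromRel (fun a b =>
    (∃ x y, a = Sum.inl x ∧ b = Sum.inl y ∧ G.Adj x y) ∨
    (∃ x y, a = Sum.inr x ∧ b = Sum.inr y ∧ H.Adj x y))

/-- The join `K₁ ∨ H` : a new vertex (`none`) adjacent to every vertex of `H`. -/
def cone {α : Type*} (H : SimpleGraph α) : SimpleGraph (Option α) :=
  SimpleGraph.fromRel (fun a b =>
    a = none ∨ ∃ x y, a = some x ∧ b = some y ∧ H.Adj x y)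

/-- The value at `i` of the signless Laplacian applied to `x`: the sum of `x i + x j` over the
neighbours `j` of `i`. -/
noncomputable def edgeSum {V : Type*} [Fintype V] (G : SimpleGraph V) (x : V → ℝ) (i : V) : ℝ :=
  letI := Classical.decRel G.Adj
  ∑ j, if G.Adj i j then x i + x j else 0

theorem signlessLap_mulVec {V : Type*} [Fintype V] [DecidableEq V] (G : SimpleGraph V)
    (x : V → ℝ) : (signlessLap G).mulVec x = edgeSum G x := by
  classical
  ext i
  simp only [signlessLap, edgeSum, Matrix.add_mulVec, Pi.add_apply, SimpleGraph.degMatrix_mulVec_apply,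
    SimpleGraph.adjMatrix_mulVec_apply]
  rw [← Finset.sum_filter, Finset.sum_add_distrib, Finset.sum_const, nsmul_eq_mul,
    ← SimpleGraph.neighborFinset_eq_filter, SimpleGraph.card_neighborFinset_eq_degree]

theorem signlessLap_nonneg {V : Type*} [Fintype V] [DecidableEq V] (G : SimpleGraph V)
    (i j : V) : 0 ≤ signlessLap G i j := by
  classical
  simp only [signlessLap, SimpleGraph.degMatrix, Matrix.add_apply, Matrix.diagonal_apply,
    SimpleGraph.adjMatrix_apply]
  split_ifs <;> positivity

theorem signlessLap_isHermitian {V : Type*} [Fintype V] [DecidableEq V] (G : SimpleGraph V) :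
    (signlessLap G).IsHermitian := by
  classical
  simp only [signlessLap, SimpleGraph.degMatrix]
  refine (Matrix.isHermitian_diagonal _).add ?_
  simp [Matrix.IsHermitian, Matrix.conjTranspose_eq_transpose_of_trivial]

/-- A positive subsolution bounds the spectrum of a nonnegative matrix from above. -/
theorem le_of_mem_spectrum_of_mulVec_le {V : Type*} [Fintype V] [DecidableEq V]
    {A : Matrix V V ℝ} (hA : ∀ i j, 0 ≤ A i j) {x : V → ℝ} (hx : ∀ i, 0 < x i) {q : ℝ}
    (h : ∀ i, A.mulVec x i ≤ q * x i) {μ : ℝ} (hμ : μ ∈ spectrum ℝ A) : μ ≤ q := by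
  rw [← Matrix.spectrum_toLin', ← Module.End.hasEigenvalue_iff_mem_spectrum] at hμ
  obtain ⟨y, hy⟩ := hμ.exists_hasEigenvector
  have hy0 : y ≠ 0 := hy.2
  have hAy : A.mulVec y = μ • y := by simpa using hy.apply_eq_smul
  obtain ⟨j, hj⟩ := Function.ne_iff.mp hy0
  have : Nonempty V := ⟨j⟩
  obtain ⟨i, hi⟩ := Finite.exists_max (fun i => |y i| / x i)
  set t := |y i| / x i with ht
  have htpos : 0 < t := (div_pos (abs_pos.mpr hj) (hx j)).trans_le (hi j)
  have hyi : |y i| = t * x i := by rw [ht, div_mul_cancel₀ _ (hx i).ne']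
  have hle : ∀ j, |y j| ≤ t * x j := fun j => (div_le_iff₀ (hx j)).mp (hi j)
  have key : μ * (t * x i) ≤ q * (t * x i) := calc
    μ * (t * x i) ≤ |μ| * |y i| := by
      rw [hyi]; exact mul_le_mul_of_nonneg_right (le_abs_self μ) (mul_pos htpos (hx i)).le
    _ = |∑ j, A i j * y j| := by
      rw [← abs_mul]
      exact congrArg abs (congrFun hAy i).symm
    _ ≤ ∑ j, |A i j * y j| := Finset.abs_sum_le_sum_abs _ _
    _ ≤ ∑ j, t * (A i j * x j) := by
      refine Finset.sum_le_sum fun j _ => ?_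
      rw [abs_mul, abs_of_nonneg (hA i j), mul_left_comm]
      exact mul_le_mul_of_nonneg_left (hle j) (hA i j)
    _ = t * A.mulVec x i := by rw [← Finset.mul_sum]; rfl
    _ ≤ t * (q * x i) := mul_le_mul_of_nonneg_left (h i) htpos.le
    _ = q * (t * x i) := by ring
  exact le_of_mul_le_mul_right key (mul_pos htpos (hx i))

/-- Rayleigh's principle, in strict form. -/
theorem lt_sSup_spectrum_of_dotProduct_lt {V : Type*} [Fintype V] [DecidableEq V]
    {A : Matrix V V ℝ} (hA : A.IsHermitian) {x : V → ℝ} {q : ℝ}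
    (h : q * (x ⬝ᵥ x) < x ⬝ᵥ A.mulVec x) : q < sSup (spectrum ℝ A) := by
  by_contra! hq
  have hbdd : BddAbove (spectrum ℝ A) := (Matrix.finite_real_spectrum (A := A)).bddAbove
  have hps : (algebraMap ℝ (Matrix V V ℝ) q - A).PosSemidef := by
    rw [Matrix.posSemidef_iff_isHermitian_and_spectrum_nonneg]
    refine ⟨?_, ?_⟩
    · rw [Matrix.algebraMap_eq_diagonal]
      exact (Matrix.isHermitian_diagonal _).sub hA
    · rw [← spectrum.singleton_sub_eq]
      rintro _ ⟨_, rfl, μ, hμ, rfl⟩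
      exact sub_nonneg.mpr ((le_csSup hbdd hμ).trans hq)
  have := hps.dotProduct_mulVec_nonneg x
  rw [Matrix.sub_mulVec, dotProduct_sub, Algebra.algebraMap_eq_smul_one, Matrix.smul_mulVec,
    Matrix.one_mulVec, dotProduct_smul] at this
  simp only [star_trivial, smul_eq_mul] at this
  linarith

theorem cone_adj_none_some {α : Type*} (H : SimpleGraph α) (a : α) :
    (cone H).Adj none (some a) := by
  simp [cone]

theorem cone_adj_some_none {α : Type*} (H : SimpleGraph α) (a : α) :
    (cone H).Adj (some a) none := (cone_adj_none_some H a).symm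

theorem cone_adj_some_some {α : Type*} (H : SimpleGraph α) (a b : α) :
    (cone H).Adj (some a) (some b) ↔ H.Adj a b := by
  simp only [cone, SimpleGraph.fromRel_adj]
  constructor
  · rintro ⟨-, h | h⟩ <;> simp at h
    exacts [h, h.symm]
  · intro h
    exact ⟨by simpa using h.ne, by simp [h]⟩

theorem edgeSum_cone_none {α : Type*} [Fintype α] (H : SimpleGraph α) (x : Option α → ℝ) :
    edgeSum (cone H) x none = Fintype.card α * x none + ∑ a, x (some a) := by
  simp [edgeSum, Fintype.sum_option, cone_adj_none_some, Finset.sum_add_distrib]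

theorem edgeSum_cone_some {α : Type*} [Fintype α] (H : SimpleGraph α) (x : Option α → ℝ)
    (a : α) : edgeSum (cone H) x (some a) =
      x (some a) + x none + edgeSum H (fun b => x (some b)) a := by
  classical
  simp only [edgeSum, Fintype.sum_option, cone_adj_some_none, if_true]
  exact congrArg _ (Finset.sum_congr rfl fun b _ =>
    if_congr (cone_adj_some_some H a b) rfl rfl)

theorem edgeSum_dUnion_inl {α β : Type*} [Fintype α] [Fintype β] (G : SimpleGraph α)
    (H : SimpleGraph β) (u : α → ℝ) (v : β → ℝ) (a : α) :
    edgeSum (dUnion G H) (Sum.elim u v) (Sum.inl a) = edgeSum G u a := by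
  have h (b : α) : (dUnion G H).Adj (Sum.inl a) (Sum.inl b) ↔ G.Adj a b := by
    simp only [dUnion, SimpleGraph.fromRel_adj]
    constructor
    · rintro ⟨-, h | h⟩ <;> simp at h
      exacts [h, h.symm]
    · intro h
      exact ⟨by simpa using h.ne, by simp [h]⟩
  have h' (b : β) : ¬ (dUnion G H).Adj (Sum.inl a) (Sum.inr b) := by simp [dUnion]
  classical
  simp only [edgeSum, Fintype.sum_sum_type, h', if_false, Finset.sum_const_zero, add_zero]
  exact Finset.sum_congr rfl fun c _ => if_congr (h c) rfl rfl

theorem edgeSum_dUnion_inr {α β : Type*} [Fintype α] [Fintype β] (G : SimpleGraph α)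
    (H : SimpleGraph β) (u : α → ℝ) (v : β → ℝ) (b : β) :
    edgeSum (dUnion G H) (Sum.elim u v) (Sum.inr b) = edgeSum H v b := by
  have h (c : β) : (dUnion G H).Adj (Sum.inr b) (Sum.inr c) ↔ H.Adj b c := by
    simp only [dUnion, SimpleGraph.fromRel_adj]
    constructor
    · rintro ⟨-, h | h⟩ <;> simp at h
      exacts [h, h.symm]
    · intro h
      exact ⟨by simpa using h.ne, by simp [h]⟩
  have h' (a : α) : ¬ (dUnion G H).Adj (Sum.inr b) (Sum.inl a) := by simp [dUnion]
  classical
  simp only [edgeSum, Fintype.sum_sum_type, h', if_false, Finset.sum_const_zero, zero_add]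
  exact Finset.sum_congr rfl fun c _ => if_congr (h c) rfl rfl

/-- `u` is positive and, extended by `1` at the apex, solves the `Q`-eigenvalue equation of
`cone H` for the value `q` at every vertex of `H`. -/
def IsConeSolution {α : Type*} [Fintype α] (H : SimpleGraph α) (q : ℝ) (u : α → ℝ) : Prop :=
  ∀ a, 0 < u a ∧ u a + 1 + edgeSum H u a = q * u a

theorem IsConeSolution.dUnion {α β : Type*} [Fintype α] [Fintype β] {G : SimpleGraph α}
    {H : SimpleGraph β} {q : ℝ} {u : α → ℝ} {v : β → ℝ} (hu : IsConeSolution G q u)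
    (hv : IsConeSolution H q v) : IsConeSolution (dUnion G H) q (Sum.elim u v) := by
  rintro (a | b)
  · simpa [edgeSum_dUnion_inl] using hu a
  · simpa [edgeSum_dUnion_inr] using hv b

theorem IsConeSolution.qIndex_le {α : Type*} [Fintype α] [DecidableEq α] {H : SimpleGraph α}
    {q : ℝ} {u : α → ℝ} (hu : IsConeSolution H q u) (hq : 0 ≤ q)
    (h : Fintype.card α + ∑ a, u a ≤ q) : qIndex (cone H) ≤ q := by
  refine Real.sSup_le (fun μ hμ => ?_) hq
  refine le_of_mem_spectrum_of_mulVec_le (signlessLap_nonneg _)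
    (x := fun o => o.elim 1 u) ?_ ?_ hμ
  · rintro (_ | a)
    · exact one_pos
    · exact (hu a).1
  · rw [signlessLap_mulVec]
    rintro (_ | a)
    · simpa [edgeSum_cone_none] using h
    · simpa [edgeSum_cone_some] using (hu a).2.le

theorem IsConeSolution.lt_qIndex {α : Type*} [Fintype α] [DecidableEq α] {H : SimpleGraph α}
    {q : ℝ} {u : α → ℝ} (hu : IsConeSolution H q u)
    (h : q < Fintype.card α + ∑ a, u a) : q < qIndex (cone H) := by
  refine lt_sSup_spectrum_of_dotProduct_lt (signlessLap_isHermitian _)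
    (x := fun o => o.elim 1 u) ?_
  have hs (a : α) : u a * (u a + 1 + edgeSum H u a) = q * (u a * u a) := by
    rw [(hu a).2]; ring
  simp only [signlessLap_mulVec, dotProduct, Fintype.sum_option, edgeSum_cone_none,
    edgeSum_cone_some, Option.elim_none, Option.elim_some, hs, mul_add, Finset.mul_sum]
  simp only [one_mul, mul_one]
  linarith

theorem isConeSolution_matching (n : ℕ) {q : ℝ} (hq : 3 < q) :
    IsConeSolution (matching n) q (fun _ => 1 / (q - 3)) := by
  rintro ⟨i, b⟩
  have h : q - 3 ≠ 0 := by linarith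
  refine ⟨by apply one_div_pos.mpr; linarith, ?_⟩
  have : edgeSum (matching n) (fun _ => 1 / (q - 3)) (i, b) = 2 * (1 / (q - 3)) := by
    rw [edgeSum, Fintype.sum_prod_type]
    rw [Finset.sum_eq_single i]
    · fin_cases b <;> simp [matching, Fin.sum_univ_two] <;> ring
    · intro j _ hj
      simp [matching, hj, hj.symm]
    · simp
  rw [this]
  field_simp
  ring

theorem isConeSolution_starGraph_three {q : ℝ} (hq : 4 < q) :
    IsConeSolution (starGraph 3) q
      ![q / ((q - 1) * (q - 4)), (q - 2) / ((q - 1) * (q - 4)), (q - 2) / ((q - 1) * (q - 4))] := by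
  have h1 : 0 < q - 1 := by linarith
  have h2 : 0 < q - 2 := by linarith
  have h4 : 0 < q - 4 := by linarith
  have h0 : 0 < q := by linarith
  intro a
  constructor
  · fin_cases a <;> simp <;> positivity
  · fin_cases a <;> simp [edgeSum, starGraph, Fin.sum_univ_three] <;> field_simp <;> ring

theorem isConeSolution_starGraph_four {q : ℝ} (hq : 5 < q) :
    IsConeSolution (starGraph 4) q
      ![(q + 1) / ((q - 1) * (q - 5)), (q - 3) / ((q - 1) * (q - 5)),
        (q - 3) / ((q - 1) * (q - 5)), (q - 3) / ((q - 1) * (q - 5))] := by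
  have h1 : 0 < q - 1 := by linarith
  have h3 : 0 < q - 3 := by linarith
  have h5 : 0 < q - 5 := by linarith
  have h0 : 0 < q := by linarith
  intro a
  constructor
  · fin_cases a <;> simp <;> positivity
  · fin_cases a <;> simp [edgeSum, starGraph, Fin.sum_univ_four] <;> field_simp <;> ring

theorem isConeSolution_pathGraph_one {q : ℝ} (hq : 1 < q) :
    IsConeSolution (pathGraph 1) q (fun _ => 1 / (q - 1)) := by
  have h : 0 < q - 1 := by linarith
  intro a
  refine ⟨by positivity, ?_⟩
  simp [edgeSum, Subsingleton.elim a 0]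
  field_simp
  ring

/-- The apex equation of `K₁ ∨ (m P₂ ∪ 2 S₃ ∪ P₁)` has a root beyond the number of vertices of
the base. -/
theorem exists_apex_eq (m : ℕ) : ∃ q : ℝ, 7 ≤ q ∧
    2 * m + 7 + (2 * m / (q - 3) + 2 * (3 * q - 4) / ((q - 1) * (q - 4)) + 1 / (q - 1)) = q := by
  let p : ℝ → ℝ := fun q => (q - (2 * m + 7)) * ((q - 1) * (q - 3) * (q - 4)) -
    (2 * m * ((q - 1) * (q - 4)) + 2 * (3 * q - 4) * (q - 3) + (q - 3) * (q - 4))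
  have hm : (0 : ℝ) ≤ m := m.cast_nonneg
  have hlo : p (2 * m + 7) ≤ 0 := by
    have : p (2 * m + 7) = -(8 * m ^ 3 + 64 * m ^ 2 + 166 * m + 148) := by simp only [p]; ring
    rw [this]
    exact neg_nonpos.mpr (by positivity)
  have hhi : 0 ≤ p (2 * m + 7 + 5) := by
    simp only [p]
    ring_nf
    positivity
  obtain ⟨q, ⟨hq, -⟩, hp⟩ := intermediate_value_Icc (by linarith : 2 * (m : ℝ) + 7 ≤ 2 * m + 7 + 5)
    (by fun_prop : ContinuousOn p _) ⟨hlo, hhi⟩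
  have h7 : 7 ≤ q := by linarith
  have h1 : q - 1 ≠ 0 := by linarith
  have h3 : q - 3 ≠ 0 := by linarith
  have h4 : q - 4 ≠ 0 := by linarith
  refine ⟨q, h7, ?_⟩
  simp only [p] at hp
  field_simp
  linear_combination -hp

theorem apex_gain {q : ℝ} (hq : 5 < q) :
    2 * (3 * q - 4) / ((q - 1) * (q - 4)) < 2 / (q - 3) + (4 * q - 8) / ((q - 1) * (q - 5)) := by
  have h1 : 0 < q - 1 := by linarith
  have h2 : 0 < q - 2 := by linarith
  have h3 : 0 < q - 3 := by linarith
  have h4 : 0 < q - 4 := by linarith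
  have h5 : 0 < q - 5 := by linarith
  rw [← sub_pos]
  have : 2 / (q - 3) + (4 * q - 8) / ((q - 1) * (q - 5)) - 2 * (3 * q - 4) / ((q - 1) * (q - 4)) =
      8 * (q - 2) / ((q - 1) * (q - 3) * (q - 4) * (q - 5)) := by
    field_simp
    ring
  rw [this]
  positivity

theorem stmt9 (k : ℕ) (hk : 3 ≤ k) :
    qIndex (cone (dUnion (matching (k - 2)) (dUnion (starGraph 4) (pathGraph 1)))) > qIndex (cone (dUnion (matching (k - 3)) (dUnion (dUnion (starGraph 3) (starGraph 3)) (pathGraph 1)))) := by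
  obtain ⟨m, rfl⟩ := Nat.exists_eq_add_of_le' hk
  obtain ⟨q, hq, hroot⟩ := exists_apex_eq m
  rw [show m + 3 - 2 = m + 1 by omega, show m + 3 - 3 = m by omega]
  have hP := isConeSolution_pathGraph_one (q := q) (by linarith)
  have hS := isConeSolution_starGraph_three (q := q) (by linarith)
  have hT := isConeSolution_starGraph_four (q := q) (by linarith)
  have hM (n : ℕ) := isConeSolution_matching n (q := q) (by linarith)
  have hsmall := (hM m).dUnion ((hS.dUnion hS).dUnion hP)
  have hbig := (hM (m + 1)).dUnion (hT.dUnion hP)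
  refine (hsmall.qIndex_le (by linarith) (le_of_eq ?_)).trans_lt (hbig.lt_qIndex ?_)
  · refine Eq.trans ?_ hroot
    simp [Fin.sum_univ_three]
    ring
  · refine hroot.symm.trans_lt ?_
    have := apex_gain (q := q) (by linarith)
    simp [Fin.sum_univ_four]
    ring_nf at this ⊢
    linarith

end QPaper
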